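/- The ⋆_c-product of 3-order tensors is computed slice-wise in the cosine domain: let A ∈ ℝ^{n1×n2×ℓ}, X ∈ ℝ^{ℓ×n2×n3}, and Y = A ⋆_c X. Then, with Ā = (C)₂.A, X̄ = (C)₂.X, and Ȳ = (C)₂.Y, for every i = 1,…,n2 one has Ȳ[:,i,:] = Ā[:,i,:]·X̄[:,i,:] (a matrix product); equivalently Y = (C^{−1})₂ applied to the tensor of slice-wise products. -/

import Mathlib

open Matrix

/-- The discrete cosine transform matrix `C̄ ∈ ℝ^{n×n}` with (1-based) entries
`C̄[i,j] = √((2 − δ_{i,1})/n)·cos((i−1)(2j−1)π/(2n))`. -/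
noncomputable def dctBar (n : ℕ) : Matrix (Fin n) (Fin n) ℝ :=
  fun i j => Real.sqrt ((2 - if i.val = 0 then 1 else 0) / n) *
    Real.cos ((i.val : ℝ) * (2 * (j.val : ℝ) + 1) * Real.pi / (2 * n))

/-- The vector `c₁ ∈ ℝ^n` with `c₁[i] = 1/C̄[i,1]`. -/
noncomputable def cOne (n : ℕ) (hn : 1 ≤ n) : Fin n → ℝ :=
  fun i => 1 / dctBar n i ⟨0, hn⟩

/-- The matrix `C = diag(c₁)·C̄`. -/
noncomputable def Cmat (n : ℕ) (hn : 1 ≤ n) : Matrix (Fin n) (Fin n) ℝ :=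
  Matrix.diagonal (cOne n hn) * dctBar n

/-- The Toeplitz-plus-Hankel matrix `Th(a) ∈ ℝ^{n×n}` (1-based formula):
`Th(a)[i,j] = a[|i−j|+1] + (1 − δ_{i+j,n+1})·b_{ij}`, where `b_{ij} = a[i+j]`
if `i+j ≤ n` and `b_{ij} = a[2(n+1)−(i+j)]` if `i+j > n`.
Indices `i j : Fin n` correspond to 1-based indices `i.val+1`, `j.val+1`. -/
noncomputable def thMat {n : ℕ} (a : Fin n → ℝ) : Matrix (Fin n) (Fin n) ℝ :=
  fun i j =>
    a ⟨i.val - j.val + (j.val - i.val), by have := i.isLt; have := j.isLt; omega⟩ +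
    if hd : i.val + j.val + 1 = n then 0
    else if hle : i.val + j.val + 2 ≤ n then a ⟨i.val + j.val + 1, by omega⟩
    else a ⟨2 * n - 1 - (i.val + j.val), by have := i.isLt; have := j.isLt; omega⟩

/-- The unit upper bidiagonal matrix `Γ ∈ ℝ^{n×n}` with `Γ[i,i] = 1`,
`Γ[i,i+1] = 1` for `i < n`, and all other entries `0`. -/
def gammaMat (n : ℕ) : Matrix (Fin n) (Fin n) ℝ :=
  fun i j => if j.val = i.val then 1 else if j.val = i.val + 1 then 1 else 0

/-- The `⋆_c`-product of 3-order tensors: with `Â = (Γ⁻¹)₂.A`, the mode-2 block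
convolution with reflective boundary conditions
`Y[:,i,:] = Σ_j ( Â[:,|i−j|+1,:] + (1 − δ_{i+j,n2+1})·B_{ij} )·X[:,j,:]`,
whose mode-2 kernel is exactly `Th` applied to the mode-2 fibers of `Â`. -/
noncomputable def starc3 {n1 n2 l n3 : ℕ}
    (A : Fin n1 → Fin n2 → Fin l → ℝ) (X : Fin l → Fin n2 → Fin n3 → ℝ) :
    Fin n1 → Fin n2 → Fin n3 → ℝ :=
  fun i1 i i3 => ∑ m : Fin l, ∑ j : Fin n2,
    thMat ((gammaMat n2)⁻¹ *ᵥ fun k => A i1 k m) i j * X m j i3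

/-- The unit upper bidiagonal matrix has determinant one. -/
theorem gammaMat_det (n : ℕ) : (gammaMat n).det = 1 := by
  have h : (gammaMat n).BlockTriangular id := by
    intro i j hij
    have hij' : j.val < i.val := hij
    simp only [gammaMat]
    rw [if_neg (by omega), if_neg (by omega)]
  rw [Matrix.det_of_isUpperTriangular h]
  simp [gammaMat]

/-- Undoing the inverse of `gammaMat`. -/
theorem gammaMat_mulVec_inv (n : ℕ) (v : Fin n → ℝ) :
    gammaMat n *ᵥ ((gammaMat n)⁻¹ *ᵥ v) = v := by
  rw [Matrix.mulVec_mulVec, Matrix.mul_nonsing_inv _ (by simp [gammaMat_det]), Matrix.one_mulVec]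

/-- The angle `kπ/(2n)` has nonzero cosine for `k < n`. -/
theorem cos_angle_ne_zero {n : ℕ} (k : Fin n) :
    Real.cos ((k.val : ℝ) * Real.pi / (2 * n)) ≠ 0 := by
  have hk : (k.val : ℝ) < n := by exact_mod_cast k.isLt
  have h0 : (0 : ℝ) ≤ k.val := by positivity
  have hn : (0 : ℝ) < n := lt_of_le_of_lt h0 hk
  have hpi := Real.pi_pos
  refine (Real.cos_pos_of_mem_Ioo ⟨?_, ?_⟩).ne'
  · have : 0 ≤ (k.val : ℝ) * Real.pi / (2 * n) := by positivity
    linarith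
  · rw [div_lt_iff₀ (by positivity)]
    nlinarith

/-- The normalisation by the first column cancels the square roots in the DCT matrix. -/
theorem Cmat_apply {n : ℕ} (hn : 1 ≤ n) (k j : Fin n) :
    Cmat n hn k j = Real.cos ((2 * (j.val : ℝ) + 1) * ((k.val : ℝ) * Real.pi / (2 * n))) /
      Real.cos ((k.val : ℝ) * Real.pi / (2 * n)) := by
  have hn' : (0 : ℝ) < n := by exact_mod_cast hn
  have hs : Real.sqrt ((2 - if k.val = 0 then 1 else 0) / (n : ℝ)) ≠ 0 := by
    refine (Real.sqrt_pos.mpr (div_pos ?_ hn')).ne'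
    split_ifs <;> norm_num
  have hc := cos_angle_ne_zero k
  have e : (k.val : ℝ) * (2 * (j.val : ℝ) + 1) * Real.pi / (2 * n) =
      (2 * (j.val : ℝ) + 1) * ((k.val : ℝ) * Real.pi / (2 * n)) := by ring
  rw [Cmat, Matrix.diagonal_mul]
  simp only [cOne, dctBar, e, Nat.cast_zero, mul_zero, zero_add, mul_one]
  field_simp

/-- The entries of a Toeplitz-plus-Hankel matrix as linear forms in its generator. -/
theorem thMat_apply {n : ℕ} (a : Fin n → ℝ) (i j : Fin n) :
    thMat a i j = ∑ m : Fin n, a m *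
      ((if i.val + m.val = j.val ∨ i.val + j.val + 1 = m.val then 1 else 0) +
        if m.val ≠ 0 ∧ (i.val = j.val + m.val ∨ i.val + j.val + m.val + 1 = 2 * n)
          then 1 else 0) := by
  have key : ∀ (x : ℕ) (hx : x < n), a ⟨x, hx⟩ =
      ∑ m : Fin n, a m * if m.val = x then 1 else 0 := by
    intro x hx
    rw [Finset.sum_eq_single ⟨x, hx⟩]
    · simp
    · intro b _ hb
      rw [if_neg (fun h => hb (Fin.ext h)), mul_zero]
    · simp
  have hi := i.isLt
  have hj := j.isLt
  simp only [thMat]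
  split_ifs with h1 h2
  · rw [key, add_zero]
    refine Finset.sum_congr rfl fun m _ => ?_
    have hm := m.isLt
    congr 1
    split_ifs <;> first | omega | norm_num
  · rw [key, key, ← Finset.sum_add_distrib]
    refine Finset.sum_congr rfl fun m _ => ?_
    have hm := m.isLt
    rw [← mul_add]
    congr 1
    split_ifs <;> first | omega | norm_num
  · rw [key, key, ← Finset.sum_add_distrib]
    refine Finset.sum_congr rfl fun m _ => ?_
    have hm := m.isLt
    rw [← mul_add]
    congr 1
    split_ifs <;> first | omega | norm_num

/-- The sum of a function against the indicator of a predicate with a unique solution. -/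
theorem sum_mul_ite_eq_of_unique {n : ℕ} (f : Fin n → ℝ) (p : Fin n → Prop) [DecidablePred p]
    (x : Fin n) (hp : ∀ i, p i ↔ i = x) : ∑ i, f i * (if p i then 1 else 0) = f x := by
  simp [hp]

/-- The reflective boundary conditions turn a shift by `m` into multiplication by
`2 cos (2mθ)`. -/
theorem sum_cos_mul_shift {n : ℕ} (k j m : Fin n) (θ : ℝ)
    (hθ : θ = (k.val : ℝ) * Real.pi / (2 * n)) :
    ∑ i : Fin n, Real.cos ((2 * (i.val : ℝ) + 1) * θ) *
      ((if i.val + m.val = j.val ∨ i.val + j.val + 1 = m.val then 1 else 0) +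
        if m.val ≠ 0 ∧ (i.val = j.val + m.val ∨ i.val + j.val + m.val + 1 = 2 * n)
          then 1 else 0) =
      Real.cos ((2 * (j.val : ℝ) + 1) * θ) *
        if m.val = 0 then 1 else 2 * Real.cos (2 * m.val * θ) := by
  have hj := j.isLt
  have hm := m.isLt
  have hn0 : (n : ℝ) ≠ 0 := by
    have : n ≠ 0 := by omega
    exact_mod_cast this
  have lower : ∑ i : Fin n, Real.cos ((2 * (i.val : ℝ) + 1) * θ) *
      (if i.val + m.val = j.val ∨ i.val + j.val + 1 = m.val then 1 else 0) =
      Real.cos ((2 * ((j.val : ℝ) - m.val) + 1) * θ) := by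
    by_cases h : m.val ≤ j.val
    · rw [sum_mul_ite_eq_of_unique _ _ ⟨j.val - m.val, by omega⟩
        (fun i => by rw [Fin.ext_iff]; simp only; omega)]
      push_cast [h]
      rfl
    · have h' : ((m.val - 1 - j.val : ℕ) : ℝ) = m.val - 1 - j.val := by
        rw [Nat.cast_sub (by omega), Nat.cast_sub (by omega)]; simp
      rw [sum_mul_ite_eq_of_unique _ _ ⟨m.val - 1 - j.val, by omega⟩
        (fun i => by rw [Fin.ext_iff]; simp only; omega)]
      simp only [h']
      rw [← Real.cos_neg]
      congr 1
      ring
  by_cases hm0 : m.val = 0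
  · simp only [hm0, ne_eq, not_true_eq_false, false_and, if_false, add_zero, if_true, mul_one]
    simpa [hm0] using lower
  have upper : ∑ i : Fin n, Real.cos ((2 * (i.val : ℝ) + 1) * θ) *
      (if m.val ≠ 0 ∧ (i.val = j.val + m.val ∨ i.val + j.val + m.val + 1 = 2 * n)
        then 1 else 0) =
      Real.cos ((2 * ((j.val : ℝ) + m.val) + 1) * θ) := by
    by_cases h : j.val + m.val < n
    · rw [sum_mul_ite_eq_of_unique _ _ ⟨j.val + m.val, h⟩
        (fun i => by rw [Fin.ext_iff]; simp only; omega)]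
      push_cast
      rfl
    · have h' : ((2 * n - 1 - j.val - m.val : ℕ) : ℝ) = 2 * n - 1 - j.val - m.val := by
        rw [Nat.cast_sub (by omega), Nat.cast_sub (by omega), Nat.cast_sub (by omega)]; simp
      rw [sum_mul_ite_eq_of_unique _ _ ⟨2 * n - 1 - j.val - m.val, by omega⟩
        (fun i => by rw [Fin.ext_iff]; simp only; omega)]
      simp only [h']
      have e : (2 * (2 * (n : ℝ) - 1 - j.val - m.val) + 1) * θ =
          (k.val : ℝ) * (2 * Real.pi) - (2 * ((j.val : ℝ) + m.val) + 1) * θ := by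
        rw [hθ]
        field_simp
        ring
      rw [e, Real.cos_nat_mul_two_pi_sub]
  simp only [mul_add, Finset.sum_add_distrib] at lower upper ⊢
  rw [lower, upper, if_neg hm0]
  have e1 : (2 * (j.val : ℝ) - 2 * m.val + 1) * θ =
      (2 * (j.val : ℝ) + 1) * θ - 2 * m.val * θ := by ring
  have e2 : (2 * (j.val : ℝ) + 2 * m.val + 1) * θ =
      (2 * (j.val : ℝ) + 1) * θ + 2 * m.val * θ := by ring
  rw [mul_sub, e1, e2, Real.cos_sub, Real.cos_add]
  ring

/-- The columns of `C * Γ` carry the weights `1, 2 cos (2θ), 2 cos (4θ), …`. -/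
theorem Cmat_mul_gammaMat_apply {n : ℕ} (hn : 1 ≤ n) (k m : Fin n) :
    (Cmat n hn * gammaMat n) k m = if m.val = 0 then 1 else
      2 * Real.cos (2 * m.val * ((k.val : ℝ) * Real.pi / (2 * n))) := by
  have hc := cos_angle_ne_zero k
  have hm := m.isLt
  rw [Matrix.mul_apply]
  split_ifs with h0
  · rw [Finset.sum_eq_single m]
    · simp [gammaMat, Cmat_apply, h0, hc]
    · intro b _ hb
      have hb' : b.val ≠ m.val := fun h => hb (Fin.ext h)
      simp only [gammaMat]
      rw [if_neg (by omega), if_neg (by omega), mul_zero]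
    · simp
  · have hg : ∀ i : Fin n, gammaMat n i m =
        (if i = m then 1 else 0) + if i = ⟨m.val - 1, by omega⟩ then 1 else 0 := by
      intro i
      simp only [gammaMat, Fin.ext_iff]
      split_ifs <;> first | omega | norm_num
    have h' : ((m.val - 1 : ℕ) : ℝ) = m.val - 1 := by
      rw [Nat.cast_sub (by omega)]; simp
    simp only [hg, mul_add, Finset.sum_add_distrib, mul_ite, mul_one, mul_zero,
      Finset.sum_ite_eq', Finset.mem_univ, if_true, Cmat_apply, h']
    set θ := (k.val : ℝ) * Real.pi / (2 * n)
    have e1 : (2 * (m.val : ℝ) + 1) * θ = 2 * m.val * θ + θ := by ring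
    have e2 : (2 * ((m.val : ℝ) - 1) + 1) * θ = 2 * m.val * θ - θ := by ring
    rw [← add_div, div_eq_iff hc, e1, e2, Real.cos_sub, Real.cos_add]
    ring

/-- The matrix `C` diagonalises every Toeplitz-plus-Hankel matrix `Th(a)`, with eigenvalues
`C Γ a`. -/
theorem Cmat_mul_thMat {n : ℕ} (hn : 1 ≤ n) (a : Fin n → ℝ) :
    Cmat n hn * thMat a =
      Matrix.diagonal (Cmat n hn *ᵥ (gammaMat n *ᵥ a)) * Cmat n hn := by
  ext k j
  rw [Matrix.diagonal_mul, Matrix.mulVec_mulVec, Matrix.mul_apply]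
  simp only [Matrix.mulVec, dotProduct, Cmat_mul_gammaMat_apply, thMat_apply, Finset.mul_sum]
  rw [Finset.sum_comm, Finset.sum_mul]
  refine Finset.sum_congr rfl fun m _ => ?_
  have h := sum_cos_mul_shift k j m _ rfl
  simp only [Cmat_apply]
  have rearrange : ∀ w a c d : ℝ, w * a * (c / d) = a / d * (c * w) := fun _ _ _ _ => by ring
  rw [rearrange, ← h, Finset.mul_sum]
  exact Finset.sum_congr rfl fun i _ => by
    simp only [div_eq_mul_inv]
    ac_rfl

/-- The `⋆_c`-product of 3-order tensors is computed slice-wise in the cosine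
domain: if `Y = A ⋆_c X` then, with `Ā = (C)₂.A`, `X̄ = (C)₂.X`, `Ȳ = (C)₂.Y`,
for every `i` one has `Ȳ[:,i,:] = Ā[:,i,:]·X̄[:,i,:]` (a matrix product). -/
theorem starc3_cosine_slicewise (n1 n2 l n3 : ℕ) (hn : 1 ≤ n2)
    (A : Fin n1 → Fin n2 → Fin l → ℝ) (X : Fin l → Fin n2 → Fin n3 → ℝ) :
    ∀ (i : Fin n2) (i1 : Fin n1) (i3 : Fin n3),
      (Cmat n2 hn *ᵥ fun k => starc3 A X i1 k i3) i =
        ∑ m : Fin l,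
          (Cmat n2 hn *ᵥ fun k => A i1 k m) i * (Cmat n2 hn *ᵥ fun k => X m k i3) i := by
  intro i i1 i3
  have h : (fun k => starc3 A X i1 k i3) = ∑ m : Fin l,
      thMat ((gammaMat n2)⁻¹ *ᵥ fun k => A i1 k m) *ᵥ fun k => X m k i3 := by
    ext k
    simp [starc3, Matrix.mulVec, dotProduct]
  rw [h, Matrix.mulVec_sum, Finset.sum_apply]
  refine Finset.sum_congr rfl fun m _ => ?_
  rw [Matrix.mulVec_mulVec, Cmat_mul_thMat, gammaMat_mulVec_inv, ← Matrix.mulVec_mulVec,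
    Matrix.mulVec_diagonal]
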